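/- Fix M, m, T ∈ ℕ with m ≤ M. Let β > 0, let p ∈ ℂ^T be nonzero, and set γ = √β · ‖p‖². Let W ∈ ℂ^{M×M} be a unitary diagonal matrix (each diagonal entry has modulus 1), and let Q_m ∈ ℂ^{M×m} satisfy Q_m^H Q_m = I_m. Let N be an M×T random matrix with i.i.d. standard complex Gaussian entries. Then E[ ‖ (1/γ) W Q_m Q_m^H W^H N p ‖² ] = m / (β ‖p‖²). -/

import Mathlib

open MeasureTheory ProbabilityTheory Matrix

/-- The standard complex Gaussian distribution `CN(0,1)`: real and imaginary parts are
independent real Gaussians with mean `0` and variance `1/2`. -/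
noncomputable def stdComplexGaussian : Measure ℂ :=
  ((gaussianReal 0 (1/2)).prod (gaussianReal 0 (1/2))).map
    (fun p : ℝ × ℝ => (p.1 : ℂ) + (p.2 : ℂ) * Complex.I)

/-- The expected squared modulus of a linear combination of i.i.d. centred complex random variables
with unit second moment is the squared norm of the coefficient vector. -/
theorem integral_norm_sum_mul_sq_pi {ι : Type*} [Fintype ι] (ν : Measure ℂ) [IsProbabilityMeasure ν]
    (hL : MemLp id 2 ν) (h_mean : ∫ z, z ∂ν = 0) (h_sq : ∫ z, ‖z‖ ^ 2 ∂ν = 1) (c : ι → ℂ) :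
    Integrable (fun z : ι → ℂ => ‖∑ x, c x * z x‖ ^ 2) (Measure.pi fun _ => ν) ∧
    ∫ z : ι → ℂ, ‖∑ x, c x * z x‖ ^ 2 ∂(Measure.pi fun _ => ν) = ∑ x, ‖c x‖ ^ 2 := by
  classical
  have hLx (x : ι) : MemLp (fun z : ι → ℂ => z x) 2 (Measure.pi fun _ => ν) :=
    hL.comp_measurePreserving (measurePreserving_eval (fun _ : ι => ν) x)
  have h_int (x y : ι) : Integrable (fun z : ι → ℂ => z x * star (z y)) (Measure.pi fun _ => ν) :=
    (hLx x).integrable_mul (hLx y).star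
  have h_mom (x y : ι) : ∫ z : ι → ℂ, z x * star (z y) ∂(Measure.pi fun _ => ν)
      = if x = y then 1 else 0 := by
    split_ifs with h
    · subst h
      have e : ∫ z : ι → ℂ, z x * star (z x) ∂(Measure.pi fun _ => ν) = ∫ z, z * star z ∂ν :=
        integral_comp_eval (μ := fun _ : ι => ν) (i := x) (f := fun z : ℂ => z * star z)
          (by fun_prop)
      rw [e]
      simp only [RCLike.star_def, Complex.mul_conj']
      have := integral_ofReal (𝕜 := ℂ) (μ := ν) (f := fun z : ℂ => ‖z‖ ^ 2)
      rw [h_sq] at this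
      simpa using this
    · have hind : IndepFun (fun z : ι → ℂ => z x) (fun z : ι → ℂ => z y)
          (Measure.pi fun _ => ν) :=
        (iIndepFun_pi (μ := fun _ : ι => ν) (X := fun _ => id) (fun _ => aemeasurable_id)).indepFun h
      have h2 := hind.comp (φ := id) (ψ := star) measurable_id (by fun_prop)
      have h3 := h2.integral_fun_mul_eq_mul_integral
        (hLx x).aestronglyMeasurable (hLx y).star.aestronglyMeasurable
      have e : ∫ z : ι → ℂ, z x ∂(Measure.pi fun _ => ν) = 0 :=
        (integral_comp_eval (μ := fun _ : ι => ν) (i := x) (f := fun z : ℂ => z)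
          (by fun_prop)).trans h_mean
      simpa [e] using h3
  have h_expand (z : ι → ℂ) : ((‖∑ x, c x * z x‖ ^ 2 : ℝ) : ℂ)
      = ∑ x, ∑ y, (c x * star (c y)) * (z x * star (z y)) := by
    push_cast
    rw [← Complex.mul_conj', ← RCLike.star_def, star_sum, Finset.sum_mul_sum]
    refine Finset.sum_congr rfl fun x _ => Finset.sum_congr rfl fun y _ => ?_
    rw [star_mul']
    ring
  have h_int' : Integrable (fun z : ι → ℂ => ‖∑ x, c x * z x‖ ^ 2) (Measure.pi fun _ => ν) :=
    (memLp_finsetSum Finset.univ fun x _ => (hLx x).const_mul (c x)).integrable_norm_pow two_ne_zero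
  refine ⟨h_int', ?_⟩
  have key := integral_ofReal (𝕜 := ℂ) (μ := Measure.pi fun _ : ι => ν)
    (f := fun z : ι → ℂ => ‖∑ x, c x * z x‖ ^ 2)
  apply Complex.ofReal_injective
  refine key.symm.trans ?_
  refine (integral_congr_ae (.of_forall h_expand)).trans ?_
  rw [integral_finsetSum _ fun x _ => integrable_finsetSum _ fun y _ => (h_int x y).const_mul _]
  push_cast
  refine Finset.sum_congr rfl fun x _ => ?_
  rw [integral_finsetSum _ fun y _ => (h_int x y).const_mul _]
  simp only [integral_const_mul, h_mom]
  simp [Complex.mul_conj']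

theorem measurable_ofReal_add_ofReal_mul_I :
    Measurable (fun p : ℝ × ℝ => (p.1 : ℂ) + (p.2 : ℂ) * Complex.I) := by
  fun_prop

instance : IsProbabilityMeasure stdComplexGaussian :=
  Measure.isProbabilityMeasure_map measurable_ofReal_add_ofReal_mul_I.aemeasurable

theorem memLp_id_stdComplexGaussian : MemLp id 2 stdComplexGaussian := by
  rw [stdComplexGaussian, memLp_map_measure_iff (by fun_prop) (by fun_prop)]
  have h := memLp_id_gaussianReal (μ := 0) (v := 1 / 2) 2
  have h1 := (h.comp_fst (gaussianReal 0 (1 / 2))).ofReal (K := ℂ)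
  have h2 := ((h.comp_snd (gaussianReal 0 (1 / 2))).ofReal (K := ℂ)).mul_const Complex.I
  exact h1.add h2

theorem integral_id_stdComplexGaussian : ∫ z, z ∂stdComplexGaussian = 0 := by
  have h := memLp_id_gaussianReal (μ := 0) (v := 1 / 2) 2
  have h1 := ((h.comp_fst (gaussianReal 0 (1 / 2))).ofReal (K := ℂ)).integrable (by norm_num)
  have h2 := (((h.comp_snd (gaussianReal 0 (1 / 2))).ofReal (K := ℂ)).mul_const
    Complex.I).integrable (by norm_num)
  rw [stdComplexGaussian, integral_map (by fun_prop) (by fun_prop)]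
  refine (integral_add h1 h2).trans ?_
  simp only [id, integral_mul_const]
  rw [integral_fun_fst (f := fun x : ℝ => (RCLike.ofReal x : ℂ)),
    integral_fun_snd (f := fun x : ℝ => (RCLike.ofReal x : ℂ)), integral_ofReal]
  simp [integral_id_gaussianReal]

theorem integral_norm_sq_stdComplexGaussian : ∫ z, ‖z‖ ^ 2 ∂stdComplexGaussian = 1 := by
  have h := memLp_id_gaussianReal (μ := 0) (v := 1 / 2) 2
  have h1 := (h.comp_fst (gaussianReal 0 (1 / 2))).integrable_sq
  have h2 := (h.comp_snd (gaussianReal 0 (1 / 2))).integrable_sq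
  have hv : ∫ x, x ^ 2 ∂(gaussianReal 0 (1 / 2)) = 1 / 2 := by
    have := variance_of_integral_eq_zero (X := id) (μ := gaussianReal 0 (1 / 2))
      aemeasurable_id (by simp)
    rw [variance_id_gaussianReal] at this
    simpa using this.symm
  rw [stdComplexGaussian, integral_map (by fun_prop) (by fun_prop)]
  have e (p : ℝ × ℝ) : ‖(p.1 : ℂ) + (p.2 : ℂ) * Complex.I‖ ^ 2 = p.1 ^ 2 + p.2 ^ 2 := by
    rw [← Complex.normSq_eq_norm_sq, Complex.normSq_add_mul_I]
  simp only [e]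
  refine (integral_add h1 h2).trans ?_
  simp only [id]
  rw [integral_fun_fst (f := fun x : ℝ => x ^ 2), integral_fun_snd (f := fun x : ℝ => x ^ 2), hv]
  norm_num

/-- The squared Frobenius norm of a matrix is the trace of `A * Aᴴ`. -/
theorem ofReal_sum_norm_sq_eq_trace {k l : Type*} [Fintype k] [Fintype l] (A : Matrix k l ℂ) :
    ((∑ i, ∑ j, ‖A i j‖ ^ 2 : ℝ) : ℂ) = (A * Aᴴ).trace := by
  simp [Matrix.trace, Matrix.mul_apply, Complex.mul_conj']

/-- variance part of Theorem 2. With `γ = √β ‖p‖²`, `W` unitary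
diagonal, `Qmᴴ Qm = I_m`, and `N` an `M × T` matrix of i.i.d. standard complex Gaussian
entries, `E[‖(1/γ) W Q_m Q_mᴴ Wᴴ N p‖²] = m / (β ‖p‖²)`. -/
theorem ssfc_estimator_variance
    {Ω : Type*} [MeasurableSpace Ω] (μ : Measure Ω) [IsProbabilityMeasure μ]
    (M m T : ℕ) (hm : m ≤ M)
    (β : ℝ) (hβ : 0 < β) (p : Fin T → ℂ) (hp : p ≠ 0)
    (W : Matrix (Fin M) (Fin M) ℂ)
    (hW : ∃ w : Fin M → ℂ, (∀ i, ‖w i‖ = 1) ∧ W = Matrix.diagonal w)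
    (Qm : Matrix (Fin M) (Fin m) ℂ) (hQ : Qmᴴ * Qm = 1)
    (N : Ω → Fin M → Fin T → ℂ)
    (hN : Measure.map (fun ω => fun x : Fin M × Fin T => N ω x.1 x.2) μ
      = Measure.pi fun _ : Fin M × Fin T => stdComplexGaussian) :
    ∫ ω, ∑ i,
        ‖(((Real.sqrt β * ∑ t, ‖p t‖ ^ 2 : ℝ) : ℂ))⁻¹ *
          ((W * Qm * Qmᴴ * Wᴴ).mulVec ((Matrix.of (N ω)).mulVec p)) i‖ ^ 2 ∂μ
      = m / (β * ∑ t, ‖p t‖ ^ 2) := by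
  have hWW : Wᴴ * W = 1 := by
    obtain ⟨w, hw, rfl⟩ := hW
    rw [Matrix.diagonal_conjTranspose, Matrix.diagonal_mul_diagonal, ← Matrix.diagonal_one]
    congr 1
    ext i
    simp [Complex.conj_mul', hw i]
  set A := W * Qm * Qmᴴ * Wᴴ with hA
  have hfro : ∑ i, ∑ j, ‖A i j‖ ^ 2 = (m : ℝ) := by
    apply Complex.ofReal_injective
    have hAA : A * Aᴴ = W * Qm * (Qmᴴ * Wᴴ) := by
      calc A * Aᴴ = W * Qm * (Qmᴴ * (Wᴴ * W) * Qm) * (Qmᴴ * Wᴴ) := by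
            simp only [hA, Matrix.conjTranspose_mul, Matrix.conjTranspose_conjTranspose,
              Matrix.mul_assoc]
        _ = W * Qm * (Qmᴴ * Wᴴ) := by rw [hWW, Matrix.mul_one, hQ, Matrix.mul_one]
    rw [ofReal_sum_norm_sq_eq_trace, hAA, Matrix.trace_mul_comm, Matrix.mul_assoc,
      ← Matrix.mul_assoc Wᴴ, hWW, Matrix.one_mul, hQ]
    simp
  set S := ∑ t, ‖p t‖ ^ 2 with hS
  have hS_pos : 0 < S := by
    obtain ⟨t, ht⟩ := Function.ne_iff.mp hp
    have ht' : p t ≠ 0 := ht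
    exact Finset.sum_pos' (fun _ _ => by positivity) ⟨t, Finset.mem_univ t, by positivity⟩
  set g : ℝ := Real.sqrt β * S with hg
  have h_meas : AEMeasurable (fun ω => fun x : Fin M × Fin T => N ω x.1 x.2) μ := by
    by_contra h
    rw [Measure.map_of_not_aemeasurable h] at hN
    exact IsProbabilityMeasure.ne_zero _ hN.symm
  have h_lin (ω : Ω) (i : Fin M) : (g : ℂ)⁻¹ * (A.mulVec ((Matrix.of (N ω)).mulVec p)) i
      = ∑ x : Fin M × Fin T, ((g : ℂ)⁻¹ * A i x.1 * p x.2) * N ω x.1 x.2 := by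
    simp only [Matrix.mulVec, dotProduct, Matrix.of_apply, Fintype.sum_prod_type, Finset.mul_sum]
    refine Finset.sum_congr rfl fun k _ => Finset.sum_congr rfl fun t _ => ?_
    ring
  have h_mom (i : Fin M) := integral_norm_sum_mul_sq_pi stdComplexGaussian
    memLp_id_stdComplexGaussian integral_id_stdComplexGaussian integral_norm_sq_stdComplexGaussian
    (fun x : Fin M × Fin T => (g : ℂ)⁻¹ * A i x.1 * p x.2)
  have h_map := integral_map h_meas
    (f := fun z : Fin M × Fin T → ℂ =>
      ∑ i, ‖∑ x : Fin M × Fin T, ((g : ℂ)⁻¹ * A i x.1 * p x.2) * z x‖ ^ 2)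
    (Continuous.aestronglyMeasurable (by fun_prop))
  simp only [h_lin]
  rw [← h_map, hN, integral_finsetSum _ fun i _ => (h_mom i).1]
  rw [Finset.sum_congr rfl fun i _ => (h_mom i).2]
  simp only [norm_mul, mul_pow, Fintype.sum_prod_type, ← Finset.mul_sum,
    ← Finset.sum_mul, ← hS, hfro]
  have hβ' : Real.sqrt β ^ 2 = β := Real.sq_sqrt hβ.le
  rw [norm_inv, Complex.norm_real, Real.norm_eq_abs, inv_pow, sq_abs, hg, mul_pow, hβ']
  field_simp
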